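/- arXiv:2211.06540 — 3 statements merged into one kernel-verified Lean document; each statement's English description precedes it below -/
import Mathlib

section
/- There exists a universal constant C > 1 such that for all A ≥ 2 and all ε, p ∈ (0,1) with ε³np² ≥ A²C, every weakly (p, A√(np))-bijumbled graph G of order n satisfies: the number of ordered pairs (u,v) of vertices with codegree deg(u,v) ≤ (1 − ε)·np² is at most ε·n². -/
/-- `D` is an orientation of the simple graph `G`: every arc of `D` lies on an edge of `G`,
and every edge of `G` is given exactly one of its two possible directions. -/
def IsOrientation {V : Type*} (G : SimpleGraph V) (D : V → V → Prop) : Prop :=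
  (∀ u v, D u v → G.Adj u v) ∧ ∀ u v, G.Adj u v → (D u v ↔ ¬ D v u)

/-- The first neighborhood (out-neighborhood) of `u` in the digraph `D`. -/
def firstNbhd {V : Type*} (D : V → V → Prop) (u : V) : Set V := {v | D u v}

/-- The second neighborhood of `u`: vertices whose shortest directed path from `u`
has exactly two arcs. -/
def secondNbhd {V : Type*} (D : V → V → Prop) (u : V) : Set V :=
  {v | ¬ D u v ∧ v ≠ u ∧ ∃ w, D u w ∧ D w v}

/-- A Seymour vertex: its second neighborhood is at least as large as its first. -/
def IsSeymourVertex {V : Type*} (D : V → V → Prop) (u : V) : Prop :=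
  (firstNbhd D u).ncard ≤ (secondNbhd D u).ncard

/-- The digraph `D` contains a Seymour vertex. -/
def HasSeymourVertex {V : Type*} (D : V → V → Prop) : Prop :=
  ∃ u, IsSeymourVertex D u

/-- The number of edges of `G` with both endpoints in `X`. -/
noncomputable def edgesIn {V : Type*} (G : SimpleGraph V) (X : Set V) : ℕ :=
  {e ∈ G.edgeSet | ∀ v ∈ e, v ∈ X}.ncard

/-- The number of edges of `G` with one endpoint in `X` and the other in `Y`. -/
noncomputable def edgesBetween {V : Type*} (G : SimpleGraph V) (X Y : Set V) : ℕ :=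
  {e ∈ G.edgeSet | ∃ x ∈ X, ∃ y ∈ Y, e = s(x, y)}.ncard

/-- A graph `G` of order `n` is weakly `(p, α)`-bijumbled if all pairs of disjoint sets
`U`, `W` with `1 ≤ |U| ≤ |W| ≤ np|U|` satisfy `|e(U,W) − p|U||W|| ≤ α √(|U||W|)`. -/
def WeaklyBijumbled {V : Type*} [Fintype V] (G : SimpleGraph V) (p α : ℝ) : Prop :=
  ∀ U W : Set V, Disjoint U W → 1 ≤ U.ncard → U.ncard ≤ W.ncard →
    (W.ncard : ℝ) ≤ (Fintype.card V : ℝ) * p * U.ncard →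
    |(edgesBetween G U W : ℝ) - p * U.ncard * W.ncard| ≤
      α * Real.sqrt (U.ncard * W.ncard)

/-- The degree of `v` in `G`. -/
noncomputable def deg {V : Type*} (G : SimpleGraph V) (v : V) : ℕ := (G.neighborSet v).ncard

/-- The codegree of `u` and `v` in `G`: the number of their common neighbors. -/
noncomputable def codeg {V : Type*} (G : SimpleGraph V) (u v : V) : ℕ :=
  (G.neighborSet u ∩ G.neighborSet v).ncard

/-- Condition (1) of `p`-typicality: the edge count of every vertex subset is close to
its expectation. -/
def PTypical1 (n : ℕ) (p : ℝ) (G : SimpleGraph (Fin n)) : Prop :=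
  ∀ X : Set (Fin n),
    |(edgesIn G X : ℝ) - (X.ncard.choose 2 : ℝ) * p| ≤
      (X.ncard : ℝ) * Real.sqrt (3 * n * p * (1 - p)) + 2 * n

/-- Condition (2) of `p`-typicality. -/
def PTypical2 (n : ℕ) (p : ℝ) (G : SimpleGraph (Fin n)) : Prop :=
  ∀ n' n'' : ℝ, ((n' * Real.log n ≤ n'' ∧ n'' ≤ n) ∨ (n' = n ∧ n'' = n)) →
    ∀ X Y : Set (Fin n), (X.ncard : ℝ) ≤ n' → (Y.ncard : ℝ) ≤ n' →
      |(edgesBetween G X Y : ℝ) - (X.ncard : ℝ) * Y.ncard * p| ≤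
        Real.sqrt (6 * n'' * p * (1 - p) * X.ncard * Y.ncard) + 2 * n''

/-- Condition (3) of `p`-typicality: all degrees are close to `np`. -/
def PTypical3 (n : ℕ) (p : ℝ) (G : SimpleGraph (Fin n)) : Prop :=
  ∀ v : Fin n,
    |(deg G v : ℝ) - n * p| ≤ Real.sqrt (6 * n * p * (1 - p) * Real.log n) + 2 * Real.log n

/-- Condition (4) of `p`-typicality: all codegrees are close to `(n-2)p²`. -/
def PTypical4 (n : ℕ) (p : ℝ) (G : SimpleGraph (Fin n)) : Prop :=
  ∀ u v : Fin n, u ≠ v →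
    |(codeg G u v : ℝ) - ((n : ℝ) - 2) * p ^ 2| ≤
      Real.sqrt (6 * n * p ^ 2 * (1 - p ^ 2) * Real.log n) + 2 * Real.log n

/-- A graph of order `n` is `p`-typical if it satisfies all four conditions. -/
def PTypical (n : ℕ) (p : ℝ) (G : SimpleGraph (Fin n)) : Prop :=
  PTypical1 n p G ∧ PTypical2 n p G ∧ PTypical3 n p G ∧ PTypical4 n p G

open Classical in
/-- Adjacency indicator. -/
noncomputable def adjI {V : Type*} (G : SimpleGraph V) (x y : V) : ℝ :=
  if G.Adj x y then 1 else 0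

open Classical in
/-- Ordered edge count. -/
noncomputable def ordE {V : Type*} (G : SimpleGraph V) (U W : Finset V) : ℝ :=
  ∑ x ∈ U, ∑ y ∈ W, adjI G x y

lemma ordE_comm {V : Type*} (G : SimpleGraph V) (U W : Finset V) :
    ordE G U W = ordE G W U := by
  unfold ordE
  rw [Finset.sum_comm]
  refine Finset.sum_congr rfl fun x _ => Finset.sum_congr rfl fun y _ => ?_
  by_cases h : G.Adj x y
  · simp [adjI, h, h.symm]
  · simp only [adjI, h, if_false]
    exact if_neg fun h2 => h h2.symm

lemma ordE_nonneg {V : Type*} (G : SimpleGraph V) (U W : Finset V) : 0 ≤ ordE G U W := by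
  unfold ordE adjI
  refine Finset.sum_nonneg fun x _ => Finset.sum_nonneg fun y _ => ?_
  split_ifs <;> norm_num

lemma edgesBetween_le_ordE {V : Type*} (G : SimpleGraph V) (U W : Finset V) :
    (edgesBetween G (U : Set V) (W : Set V) : ℝ) ≤ ordE G U W := by
  classical
  have h1 : ordE G U W = (((U ×ˢ W).filter (fun q => G.Adj q.1 q.2)).card : ℝ) := by
    unfold ordE adjI
    rw [← Finset.sum_product', Finset.card_filter]
    push_cast
    exact Finset.sum_congr rfl fun x _ => by congr
  rw [h1]
  have h2 : {e ∈ G.edgeSet | ∃ x ∈ (U : Set V), ∃ y ∈ (W : Set V), e = s(x, y)} ⊆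
      ((((U ×ˢ W).filter (fun q => G.Adj q.1 q.2)).image (fun q => s(q.1, q.2)) :
        Finset (Sym2 V)) : Set (Sym2 V)) := by
    rintro e ⟨he, x, hx, y, hy, rfl⟩
    simp only [Finset.coe_image, Set.mem_image]
    exact ⟨(x, y), by simpa using ⟨⟨hx, hy⟩, he⟩, rfl⟩
  have h3 := Set.ncard_le_ncard h2 (Finset.finite_toSet _)
  rw [Set.ncard_coe_finset] at h3
  unfold edgesBetween
  exact_mod_cast h3.trans Finset.card_image_le

lemma lower_disj_aux {n : ℕ} (G : SimpleGraph (Fin n)) {p A : ℝ} (hA : 2 ≤ A) (hp : 0 < p)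
    (hG : WeaklyBijumbled G p (A * Real.sqrt (n * p))) (U W : Finset (Fin n))
    (hd : Disjoint U W) (hle : U.card ≤ W.card) :
    p * U.card * W.card - A * Real.sqrt (n * p) * Real.sqrt (U.card * W.card) ≤ ordE G U W := by
  have hWn : (W.card : ℝ) ≤ n := by
    have := W.card_le_univ
    rw [Fintype.card_fin] at this
    exact_mod_cast this
  by_cases h1 : 1 ≤ U.card ∧ (W.card : ℝ) ≤ n * p * U.card
  · have h := hG (U : Set (Fin n)) (W : Set (Fin n)) (by exact_mod_cast hd)
      (by rw [Set.ncard_coe_finset]; exact h1.1)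
      (by rw [Set.ncard_coe_finset, Set.ncard_coe_finset]; exact hle)
      (by rw [Set.ncard_coe_finset, Set.ncard_coe_finset, Fintype.card_fin]; exact h1.2)
    rw [Set.ncard_coe_finset, Set.ncard_coe_finset] at h
    have h2 := (abs_le.1 h).1
    have h3 := edgesBetween_le_ordE G U W
    linarith
  · refine le_trans ?_ (ordE_nonneg G U W)
    rw [sub_nonpos]
    have hU0 : (0 : ℝ) ≤ U.card := Nat.cast_nonneg _
    have hW0 : (0 : ℝ) ≤ W.card := Nat.cast_nonneg _
    have hn0 : (0 : ℝ) ≤ n := Nat.cast_nonneg _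
    have key : (n : ℝ) * p * U.card ≤ W.card := by
      rcases not_and_or.1 h1 with h | h
      · have : U.card = 0 := by omega
        simp [this]
      · exact (not_le.1 h).le
    have h5 : p * U.card * W.card ≤ Real.sqrt (n * p) * Real.sqrt (U.card * W.card) := by
      rw [← Real.sqrt_mul (by positivity)]
      apply Real.le_sqrt_of_sq_le
      have e1 : p * U.card * W.card ≤ p * U.card * n := by gcongr
      have e2 : p * U.card * W.card ≤ W.card := by
        calc _ ≤ p * U.card * n := e1
          _ = n * p * U.card := by ring
          _ ≤ _ := key
      calc (p * U.card * W.card) ^ 2 = (p * U.card * W.card) * (p * U.card * W.card) := by ring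
        _ ≤ (p * U.card * n) * W.card := by gcongr
        _ = _ := by ring
    have h6 : 0 ≤ Real.sqrt (n * p) * Real.sqrt (U.card * W.card) := by positivity
    nlinarith

lemma lower_disj {n : ℕ} (G : SimpleGraph (Fin n)) {p A : ℝ} (hA : 2 ≤ A) (hp : 0 < p)
    (hG : WeaklyBijumbled G p (A * Real.sqrt (n * p))) (U W : Finset (Fin n))
    (hd : Disjoint U W) :
    p * U.card * W.card - A * Real.sqrt (n * p) * Real.sqrt (U.card * W.card) ≤ ordE G U W := by
  rcases le_total U.card W.card with h | h
  · exact lower_disj_aux G hA hp hG U W hd h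
  · have := lower_disj_aux G hA hp hG W U hd.symm h
    rw [ordE_comm, mul_comm (W.card : ℝ) U.card] at this
    linarith

lemma card_sep {n : ℕ} (x y : Fin n) (h : x ≠ y) :
    4 * (((Finset.univ : Finset (Finset (Fin n))).filter
      (fun S => x ∈ S ∧ y ∉ S)).card : ℝ) = 2 ^ n := by
  have h1 : (Finset.univ : Finset (Finset (Fin n))).filter (fun S => x ∈ S ∧ y ∉ S)
      = Finset.Icc {x} {y}ᶜ := by
    ext S
    simp [Finset.mem_Icc, Finset.subset_compl_singleton]
  rw [h1, Finset.card_Icc_finset (by simpa using h.symm)]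
  rw [Finset.card_compl, Finset.card_singleton, Finset.card_singleton, Fintype.card_fin]
  have hn : 2 ≤ n := by
    have := x.2; have := y.2
    have : (x : ℕ) ≠ y := fun e => h (Fin.ext e)
    omega
  obtain ⟨k, rfl⟩ := Nat.exists_eq_add_of_le hn
  have : 2 + k - 1 - 1 = k := by omega
  rw [this]
  push_cast
  ring

lemma avg_sep {n : ℕ} (f : Fin n → Fin n → ℝ) (hf : ∀ x, f x x = 0) (U W : Finset (Fin n)) :
    4 * ∑ S : Finset (Fin n), ∑ x ∈ U.filter (· ∈ S), ∑ y ∈ W.filter (· ∉ S), f x y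
      = 2 ^ n * ∑ x ∈ U, ∑ y ∈ W, f x y := by
  have h1 : ∀ S : Finset (Fin n), ∑ x ∈ U.filter (· ∈ S), ∑ y ∈ W.filter (· ∉ S), f x y
      = ∑ x ∈ U, ∑ y ∈ W, if x ∈ S ∧ y ∉ S then f x y else 0 := by
    intro S
    rw [Finset.sum_filter]
    refine Finset.sum_congr rfl fun x _ => ?_
    by_cases hx : x ∈ S
    · simp [hx, Finset.sum_filter]
    · simp [hx]
  simp_rw [h1]
  rw [Finset.sum_comm, Finset.mul_sum, Finset.mul_sum]
  refine Finset.sum_congr rfl fun x _ => ?_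
  rw [Finset.sum_comm, Finset.mul_sum, Finset.mul_sum]
  refine Finset.sum_congr rfl fun y _ => ?_
  by_cases hxy : x = y
  · subst hxy; simp [hf]
  · rw [← card_sep x y hxy, ← Finset.sum_filter, Finset.sum_const, nsmul_eq_mul]
    ring

lemma lower_all {n : ℕ} (G : SimpleGraph (Fin n)) {p A : ℝ} (hA : 2 ≤ A) (hp : 0 < p)
    (hG : WeaklyBijumbled G p (A * Real.sqrt (n * p))) (hnp : 1 ≤ n * p) (hp1 : p < 1)
    (U W : Finset (Fin n)) :
    p * U.card * W.card - 5 * A * Real.sqrt (n * p) * Real.sqrt (U.card * W.card)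
      ≤ ordE G U W := by
  set f : Fin n → Fin n → ℝ := fun x y => if x = y then 0 else adjI G x y - p with hfdef
  have havg := avg_sep f (by simp [hfdef]) U W
  set R := A * Real.sqrt (n * p) * Real.sqrt (U.card * W.card) with hR
  have hlow : ∀ S : Finset (Fin n),
      -R ≤ ∑ x ∈ U.filter (· ∈ S), ∑ y ∈ W.filter (· ∉ S), f x y := by
    intro S
    have hdis : Disjoint (U.filter (· ∈ S)) (W.filter (· ∉ S)) := by
      rw [Finset.disjoint_left]
      intro a ha hb
      exact (Finset.mem_filter.1 hb).2 (Finset.mem_filter.1 ha).2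
    have h := lower_disj G hA hp hG _ _ hdis
    have e : ∑ x ∈ U.filter (· ∈ S), ∑ y ∈ W.filter (· ∉ S), f x y
        = ordE G (U.filter (· ∈ S)) (W.filter (· ∉ S))
          - p * (U.filter (· ∈ S)).card * (W.filter (· ∉ S)).card := by
      have : ∑ x ∈ U.filter (· ∈ S), ∑ y ∈ W.filter (· ∉ S), f x y
        = ∑ x ∈ U.filter (· ∈ S), ∑ y ∈ W.filter (· ∉ S), (adjI G x y - p) := by
        refine Finset.sum_congr rfl fun x hx => Finset.sum_congr rfl fun y hy => ?_
        have : x ≠ y := by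
          rintro rfl
          exact (Finset.mem_filter.1 hy).2 (Finset.mem_filter.1 hx).2
        simp [hfdef, this]
      rw [this]
      simp only [Finset.sum_sub_distrib, Finset.sum_const, nsmul_eq_mul, ordE]
      ring
    have hs : A * Real.sqrt (n * p) *
        Real.sqrt ((U.filter (· ∈ S)).card * (W.filter (· ∉ S)).card) ≤ R := by
      rw [hR]
      gcongr <;> exact Finset.filter_subset _ _
    rw [e]
    linarith
  have hsum : -(2 ^ n * R) ≤
      ∑ S : Finset (Fin n), ∑ x ∈ U.filter (· ∈ S), ∑ y ∈ W.filter (· ∉ S), f x y := by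
    have := Finset.sum_le_sum (fun S (_ : S ∈ (Finset.univ : Finset (Finset (Fin n)))) => hlow S)
    rw [Finset.sum_const, nsmul_eq_mul, Finset.card_univ, Fintype.card_finset,
      Fintype.card_fin] at this
    push_cast at this
    linarith
  have h2 : (0 : ℝ) < 2 ^ n := by positivity
  have h3 : -(4 * R) ≤ ∑ x ∈ U, ∑ y ∈ W, f x y := by
    have : 2 ^ n * (-(4 * R)) ≤ 2 ^ n * ∑ x ∈ U, ∑ y ∈ W, f x y := by
      rw [← havg]; linarith
    exact le_of_mul_le_mul_left this h2
  have h4 : ∑ x ∈ U, ∑ y ∈ W, f x y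
      ≤ ordE G U W - p * U.card * W.card + p * (U ∩ W).card := by
    have : ∀ x y, f x y = adjI G x y - p + (if x = y then p else 0) := by
      intro x y
      by_cases h : x = y
      · subst h; simp [hfdef, adjI]
      · simp [hfdef, h]
    simp only [this, Finset.sum_add_distrib, Finset.sum_sub_distrib, Finset.sum_const,
      nsmul_eq_mul, ordE, Finset.sum_ite_eq]
    rw [← Finset.sum_filter, Finset.sum_const, nsmul_eq_mul, Finset.filter_mem_eq_inter]
    linarith
  have h5 : p * (U ∩ W).card ≤ R := by
    have hc : ((U ∩ W).card : ℝ) ≤ Real.sqrt (U.card * W.card) := by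
      apply Real.le_sqrt_of_sq_le
      rw [sq]
      gcongr
      · exact Finset.inter_subset_left
      · exact Finset.inter_subset_right
    have hs1 : 1 ≤ Real.sqrt (n * p) := Real.one_le_sqrt.2 hnp
    have hc0 : (0 : ℝ) ≤ (U ∩ W).card := Nat.cast_nonneg _
    have : 1 ≤ A * Real.sqrt (n * p) := by nlinarith
    calc p * (U ∩ W).card ≤ 1 * (U ∩ W).card := by gcongr
      _ ≤ (A * Real.sqrt (n * p)) * Real.sqrt (U.card * W.card) := by gcongr
  have : 5 * A * Real.sqrt (n * p) * Real.sqrt (U.card * W.card) = 5 * R := by rw [hR]; ring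
  rw [this]
  linarith

/-- If all vertices of `B` have at most `t` neighbours in `D`, then `B` is small. -/
lemma small_of_low {n : ℕ} (G : SimpleGraph (Fin n)) {p A : ℝ} (hA : 2 ≤ A) (hp : 0 < p)
    (hG : WeaklyBijumbled G p (A * Real.sqrt (n * p))) (hnp : 1 ≤ n * p) (hp1 : p < 1)
    (B D : Finset (Fin n)) (δ : ℝ) (hδ : 0 ≤ δ)
    (h : ∀ x ∈ B, ∑ y ∈ D, adjI G x y ≤ p * D.card * (1 - δ)) :
    δ ^ 2 * p * B.card * D.card ≤ 25 * A ^ 2 * n := by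
  have h1 := lower_all G hA hp hG hnp hp1 B D
  have h2 : ordE G B D ≤ B.card * (p * D.card * (1 - δ)) := by
    have := Finset.sum_le_sum h
    rw [Finset.sum_const, nsmul_eq_mul] at this
    exact this
  have hB : (0 : ℝ) ≤ B.card := Nat.cast_nonneg _
  have hD : (0 : ℝ) ≤ D.card := Nat.cast_nonneg _
  have h3 : δ * p * (B.card * D.card)
      ≤ 5 * A * Real.sqrt (n * p) * Real.sqrt (B.card * D.card) := by linarith
  have h4 := pow_le_pow_left₀ (by positivity) h3 2
  rw [mul_pow (5 * A * _), mul_pow (5 * A), Real.sq_sqrt (by positivity),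
    Real.sq_sqrt (by positivity)] at h4
  by_cases hz : (B.card * D.card : ℝ) = 0
  · rw [mul_assoc, hz]; simp; positivity
  · have hpos : (0 : ℝ) < p * (B.card * D.card) := by positivity
    refine le_of_mul_le_mul_right ?_ hpos
    linarith

lemma sum_adjI {n : ℕ} (G : SimpleGraph (Fin n)) (x : Fin n) (D : Finset (Fin n)) (u : Fin n)
    (hD : ∀ y, y ∈ D ↔ G.Adj u y) :
    ∑ y ∈ D, adjI G x y = codeg G x u := by
  classical
  unfold adjI codeg
  rw [Finset.sum_boole]
  congr 1
  rw [← Set.ncard_coe_finset]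
  congr 1
  ext y
  simp [hD, and_comm]

/-- There is a universal constant `C > 1` such that for all `A ≥ 2` and
`ε, p ∈ (0,1)` with `ε³np² ≥ A²C`, every weakly `(p, A√(np))`-bijumbled graph of order `n`
has at most `εn²` ordered pairs `(u,v)` of vertices with codegree at most `(1 − ε)np²`. -/
theorem weakly_bijumbled_codegree_concentration :
    ∃ C : ℝ, 1 < C ∧ ∀ A : ℝ, 2 ≤ A → ∀ ε p : ℝ,
      ε ∈ Set.Ioo (0 : ℝ) 1 → p ∈ Set.Ioo (0 : ℝ) 1 → ∀ n : ℕ,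
      A ^ 2 * C ≤ ε ^ 3 * n * p ^ 2 →
      ∀ G : SimpleGraph (Fin n), WeaklyBijumbled G p (A * Real.sqrt (n * p)) →
        (({uv : Fin n × Fin n |
            (codeg G uv.1 uv.2 : ℝ) ≤ (1 - ε) * n * p ^ 2}).ncard : ℝ) ≤ ε * n ^ 2 := by
  classical
  refine ⟨1000, by norm_num, ?_⟩
  rintro A hA ε p ⟨hε, hε1⟩ ⟨hp, hp1⟩ n hC G hG
  have hn0 : (0 : ℝ) ≤ n := Nat.cast_nonneg _
  have hA2 : 4 ≤ A ^ 2 := by nlinarith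
  have hε3 : ε ^ 3 ≤ 1 := pow_le_one₀ hε.le hε1.le
  have hnp : 1 ≤ n * p := by
    have e1 : ε ^ 3 * n * p ^ 2 ≤ 1 * n * p ^ 2 := by gcongr
    have e2 : (n : ℝ) * p ^ 2 ≤ n * p := by
      have : p ^ 2 ≤ p := by nlinarith
      gcongr
    linarith
  have hn : (0 : ℝ) < n := by
    rcases hn0.eq_or_lt with h | h
    · rw [← h] at hnp; norm_num at hnp
    · exact h
  let N : Fin n → Finset (Fin n) := fun u => Finset.univ.filter (fun y => G.Adj u y)
  let L : Finset (Fin n) := Finset.univ.filter (fun u => ((N u).card : ℝ) ≤ (1 - ε / 4) * (n * p))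
  have hL : (L.card : ℝ) ≤ ε / 2 * n := by
    have h := small_of_low G hA hp hG hnp hp1 L Finset.univ (ε / 4) (by positivity) (by
      intro x hx
      have hx2 := (Finset.mem_filter.1 hx).2
      have : ∑ y, adjI G x y = (N x).card := by
        simp [adjI, N, Finset.sum_boole]
      rw [this, Finset.card_univ, Fintype.card_fin]
      linarith)
    rw [Finset.card_univ, Fintype.card_fin] at h
    have h' : (ε / 4) ^ 2 * p * L.card ≤ 25 * A ^ 2 := le_of_mul_le_mul_right h hn
    have h3 : ε ^ 3 * n * p ^ 2 ≤ ε ^ 3 * n * p := by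
      have : p ^ 2 ≤ p := by nlinarith
      gcongr
    have hpos : 0 < ε ^ 2 * p := by positivity
    refine le_of_mul_le_mul_left ?_ hpos
    nlinarith
  have hB : ∀ u, u ∉ L → ((Finset.univ.filter
      (fun v => (codeg G v u : ℝ) ≤ (1 - ε) * n * p ^ 2)).card : ℝ) ≤ ε / 2 * n := by
    intro u hu
    have hd : (1 - ε / 4) * (n * p) < (N u).card := by
      by_contra h
      exact hu (Finset.mem_filter.2 ⟨Finset.mem_univ _, not_lt.1 h⟩)
    set B := Finset.univ.filter (fun v => (codeg G v u : ℝ) ≤ (1 - ε) * n * p ^ 2) with hBdef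
    have h := small_of_low G hA hp hG hnp hp1 B (N u) (3 * ε / 4) (by positivity) (by
      intro x hx
      have hx2 := (Finset.mem_filter.1 hx).2
      rw [sum_adjI G x (N u) u (by simp [N])]
      refine hx2.trans ?_
      have e1 : (1 - ε / 4) * (n * p) * (1 - 3 * ε / 4) ≤ (N u).card * (1 - 3 * ε / 4) := by
        apply mul_le_mul_of_nonneg_right hd.le
        linarith
      have e2 : (1 - ε) * (n * p) ≤ (1 - ε / 4) * (n * p) * (1 - 3 * ε / 4) := by
        have : 0 ≤ ε ^ 2 * (n * p) := by positivity
        nlinarith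
      have e3 := mul_le_mul_of_nonneg_left (e2.trans e1) hp.le
      linarith)
    have hd2 : 3 / 4 * (n * p) ≤ (N u).card := by
      have : 0 ≤ (1 - ε) * (n * p) := mul_nonneg (by linarith) (by positivity)
      linarith
    have h2 : (3 * ε / 4) ^ 2 * p * B.card * (3 / 4 * (n * p)) ≤ 25 * A ^ 2 * n :=
      le_trans (by gcongr) h
    have h3 : (3 * ε / 4) ^ 2 * p * B.card * (3 / 4 * p) ≤ 25 * A ^ 2 :=
      le_of_mul_le_mul_right (by linarith) hn
    have hpos : 0 < ε ^ 2 * p ^ 2 := by positivity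
    refine le_of_mul_le_mul_left ?_ hpos
    nlinarith
  have hset : {uv : Fin n × Fin n | (codeg G uv.1 uv.2 : ℝ) ≤ (1 - ε) * n * p ^ 2}
      = ((Finset.univ.filter (fun uv : Fin n × Fin n =>
          (codeg G uv.1 uv.2 : ℝ) ≤ (1 - ε) * n * p ^ 2) : Finset (Fin n × Fin n)) :
          Set (Fin n × Fin n)) := by
    ext; simp
  rw [hset, Set.ncard_coe_finset]
  have hcount : ((Finset.univ.filter (fun uv : Fin n × Fin n =>
          (codeg G uv.1 uv.2 : ℝ) ≤ (1 - ε) * n * p ^ 2)).card : ℝ)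
      = ∑ u : Fin n, ((Finset.univ.filter
        (fun v => (codeg G v u : ℝ) ≤ (1 - ε) * n * p ^ 2)).card : ℝ) := by
    simp only [Finset.card_filter]
    push_cast
    rw [Fintype.sum_prod_type, Finset.sum_comm]
  rw [hcount]
  have hbound : ∀ u : Fin n, ((Finset.univ.filter
        (fun v => (codeg G v u : ℝ) ≤ (1 - ε) * n * p ^ 2)).card : ℝ)
      ≤ ε / 2 * n + (if u ∈ L then (n : ℝ) else 0) := by
    intro u
    by_cases hu : u ∈ L
    · have h := Finset.card_le_univ (Finset.univ.filter
        (fun v => (codeg G v u : ℝ) ≤ (1 - ε) * n * p ^ 2))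
      rw [Fintype.card_fin] at h
      have h' : ((Finset.univ.filter
        (fun v => (codeg G v u : ℝ) ≤ (1 - ε) * n * p ^ 2)).card : ℝ) ≤ n := by exact_mod_cast h
      rw [if_pos hu]
      have : 0 ≤ ε / 2 * n := by positivity
      linarith
    · rw [if_neg hu, add_zero]
      exact hB u hu
  refine (Finset.sum_le_sum fun u _ => hbound u).trans ?_
  rw [Finset.sum_add_distrib, Finset.sum_const, nsmul_eq_mul, Finset.card_univ, Fintype.card_fin,
    ← Finset.sum_filter, Finset.sum_const, nsmul_eq_mul, Finset.filter_mem_eq_inter,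
    Finset.univ_inter]
  nlinarith
end

section
/- For every N ∈ ℕ, every p ∈ (0,1) and every x > 0, if B is a binomial random variable with parameters N and p (the number of successes in N mutually independent trials, each with success probability p), then Pr[ |B − Np| > √(6·Np(1−p)·x) + 2x ] < 2·exp(−3x). -/
lemma bern_aux1 (u : ℝ) (hu : 0 ≤ u) : 0 ≤ u + 2 - 2 * Real.exp u + u * Real.exp u := by
  have hd : ∀ y : ℝ, HasDerivAt (fun u : ℝ => u + 2 - 2 * Real.exp u + u * Real.exp u)
      (1 - 2 * Real.exp y + (1 * Real.exp y + y * Real.exp y)) y := fun y =>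
    ((((hasDerivAt_id y).add_const 2).sub ((Real.hasDerivAt_exp y).const_mul 2)).add
      ((hasDerivAt_id y).mul (Real.hasDerivAt_exp y)))
  have hm : Monotone (fun u : ℝ => u + 2 - 2 * Real.exp u + u * Real.exp u) := by
    apply monotone_of_hasDerivAt_nonneg hd
    intro y
    have h1 := Real.add_one_le_exp (-y)
    have h2 : Real.exp (-y) * Real.exp y = 1 := by rw [← Real.exp_add]; simp
    have h3 := Real.exp_pos y
    show 0 ≤ _
    nlinarith
  have := hm hu
  simpa using this

lemma bern_aux2 (u : ℝ) (hu : 0 ≤ u) :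
    (1 - u / 3) * (Real.exp u - 1 - u) ≤ u ^ 2 / 2 := by
  let f : ℝ → ℝ := fun u => u ^ 2 / 2 - (1 - u / 3) * (Real.exp u - 1 - u)
  have hd : ∀ y : ℝ, HasDerivAt f ((y + 2 - 2 * Real.exp y + y * Real.exp y) / 3) y := by
    intro y
    have h1 : HasDerivAt (fun u : ℝ => u ^ 2 / 2) _ y := ((hasDerivAt_id y).pow 2).div_const 2
    have h2 : HasDerivAt (fun u : ℝ => 1 - u / 3) _ y :=
      ((hasDerivAt_id y).div_const 3).const_sub 1
    have h3 : HasDerivAt (fun u : ℝ => Real.exp u - 1 - u) _ y :=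
      ((Real.hasDerivAt_exp y).sub_const 1).sub (hasDerivAt_id y)
    refine HasDerivAt.congr_deriv (f := f) (h1.sub (h2.mul h3)) ?_
    simp
    ring
  have hm : MonotoneOn f (Set.Ici 0) := by
    apply monotoneOn_of_deriv_nonneg (convex_Ici 0)
    · exact fun y _ => (hd y).continuousAt.continuousWithinAt
    · exact fun y _ => (hd y).differentiableAt.differentiableWithinAt
    · intro y hy
      rw [interior_Ici] at hy
      rw [(hd y).deriv]
      have := bern_aux1 y (le_of_lt hy)
      positivity
  have := hm (Set.mem_Ici.2 le_rfl) (Set.mem_Ici.2 hu) hu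
  simp [f] at this
  linarith

lemma bern_aux3 (u : ℝ) (hu : 0 ≤ u) : Real.exp (-u) ≤ 1 - u + u ^ 2 / 2 := by
  have h := Real.quadratic_le_exp_of_nonneg hu
  have h2 : Real.exp (-u) * Real.exp u = 1 := by rw [← Real.exp_add]; simp
  have h3 := Real.exp_pos (-u)
  have h4 : Real.exp (-u) * (1 + u + u ^ 2 / 2) ≤ 1 := by nlinarith
  have h5 : (0:ℝ) < 1 + u + u ^ 2 / 2 := by positivity
  have h6 : 1 ≤ (1 - u + u ^ 2 / 2) * (1 + u + u ^ 2 / 2) := by nlinarith [sq_nonneg (u ^ 2)]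
  exact le_of_mul_le_mul_right (h4.trans h6) h5

lemma bern_mgf (p q l : ℝ) (hp : 0 < p) (hq : 0 < q) (hpq : p + q = 1) (hl : 0 ≤ l)
    (hl3 : l < 3) :
    p * Real.exp (l * q) + q * Real.exp (-(l * p)) ≤
      Real.exp (p * q * l ^ 2 / (2 * (1 - l / 3))) := by
  have hD : 0 < 1 - l / 3 := by linarith
  have hD1 : 1 - l / 3 ≤ 1 := by linarith
  have h1 : Real.exp (l * q) ≤ 1 + l * q + (l * q) ^ 2 / (2 * (1 - l / 3)) := by
    have ha := bern_aux2 (l * q) (by positivity)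
    have hb := Real.add_one_le_exp (l * q)
    have hc : l * q ≤ l := by nlinarith
    have hd : (1 - l / 3) * (Real.exp (l * q) - 1 - l * q) ≤ (l * q) ^ 2 / 2 :=
      le_trans (mul_le_mul_of_nonneg_right (by linarith) (by linarith)) ha
    have : Real.exp (l * q) - 1 - l * q ≤ (l * q) ^ 2 / (2 * (1 - l / 3)) := by
      rw [le_div_iff₀ (by positivity)]
      linarith
    linarith
  have h2 : Real.exp (-(l * p)) ≤ 1 - l * p + (l * p) ^ 2 / (2 * (1 - l / 3)) := by
    have ha := bern_aux3 (l * p) (by positivity)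
    have : (l * p) ^ 2 / 2 ≤ (l * p) ^ 2 / (2 * (1 - l / 3)) := by
      apply div_le_div_of_nonneg_left (by positivity) (by positivity) (by linarith)
    linarith
  have h3 := Real.add_one_le_exp (p * q * l ^ 2 / (2 * (1 - l / 3)))
  refine le_trans ?_ h3
  have h4 : p * (1 + l * q + (l * q) ^ 2 / (2 * (1 - l / 3))) +
      q * (1 - l * p + (l * p) ^ 2 / (2 * (1 - l / 3))) =
      p * q * l ^ 2 / (2 * (1 - l / 3)) + 1 := by
    obtain rfl : q = 1 - p := by linarith
    ring
  rw [← h4]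
  gcongr

lemma bern_pow (N : ℕ) (p q a b : ℝ) :
    ∑ k ∈ Finset.range (N + 1), (N.choose k : ℝ) * p ^ k * q ^ (N - k) *
      Real.exp (k * a + (N - k) * b) = (p * Real.exp a + q * Real.exp b) ^ N := by
  rw [add_pow]
  apply Finset.sum_congr rfl
  intro k hk
  have hk' : k ≤ N := by simpa [Nat.lt_succ_iff] using hk
  rw [Real.exp_add, ← Nat.cast_sub hk', Real.exp_nat_mul, Real.exp_nat_mul, mul_pow, mul_pow]
  ring

/-- (Chernoff-type bound for the binomial distribution.) If
`B ~ Binomial(N,p)`, i.e., `Pr[B = k] = C(N,k) p^k (1-p)^{N-k}`, then for every `x > 0`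
we have `Pr[|B − Np| > √(6 Np(1−p) x) + 2x] < 2 exp(−3x)`. -/
theorem binomial_chernoff_two_term (N : ℕ) (p : ℝ) (hp : p ∈ Set.Ioo (0 : ℝ) 1)
    (x : ℝ) (hx : 0 < x) :
    (∑ k ∈ Finset.range (N + 1),
        if Real.sqrt (6 * N * p * (1 - p) * x) + 2 * x < |(k : ℝ) - N * p| then
          (N.choose k : ℝ) * p ^ k * (1 - p) ^ (N - k)
        else 0)
      < 2 * Real.exp (-3 * x) := by
  obtain ⟨hp0, hp1⟩ := hp
  rcases Nat.eq_zero_or_pos N with rfl | hN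
  · have : ¬ (2 * x < 0) := by linarith
    simp [this, Real.exp_pos]
  have hN' : (0:ℝ) < N := by exact_mod_cast hN
  obtain ⟨q, hq⟩ : ∃ q, q = 1 - p := ⟨_, rfl⟩
  rw [← hq]
  have hq0 : 0 < q := by linarith
  set s := Real.sqrt (6 * N * p * q * x) with hs
  have hs2 : s ^ 2 = 6 * N * p * q * x := Real.sq_sqrt (by positivity)
  have hs0 : 0 ≤ s := Real.sqrt_nonneg _
  obtain ⟨t, ht⟩ : ∃ t, t = s + 2 * x := ⟨_, rfl⟩
  rw [← ht]
  have ht0 : 0 < t := by linarith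
  obtain ⟨v, hv⟩ : ∃ v, v = N * (p * q) := ⟨_, rfl⟩
  have hv0 : 0 < v := by rw [hv]; positivity
  obtain ⟨l, hl⟩ : ∃ l, l = t / (v + t / 3) := ⟨_, rfl⟩
  have hl0 : 0 < l := by rw [hl]; positivity
  have hl3 : l < 3 := by
    rw [hl, div_lt_iff₀ (by positivity)]; linarith
  have hD : 1 - l / 3 = v / (v + t / 3) := by
    rw [hl]; field_simp; ring
  have hexp : N * (p * q * l ^ 2 / (2 * (1 - l / 3))) - l * t ≤ -3 * x := by
    have : N * (p * q * l ^ 2 / (2 * (1 - l / 3))) - l * t = - (t ^ 2 / (2 * (v + t / 3))) := by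
      have : N * (p * q * l ^ 2 / (2 * (1 - l / 3))) = v * l ^ 2 / (2 * (1 - l / 3)) := by
        rw [hv]; ring
      rw [this, hD, hl]
      field_simp
      ring
    rw [this]
    have : 3 * x ≤ t ^ 2 / (2 * (v + t / 3)) := by
      rw [le_div_iff₀ (by positivity), ht, hv]
      nlinarith [mul_nonneg hs0 hx.le]
    linarith
  have hbound : ∀ M : ℝ, 0 ≤ M → M ≤ Real.exp (p * q * l ^ 2 / (2 * (1 - l / 3))) →
      M ^ N * Real.exp (-(l * t)) ≤ Real.exp (-3 * x) := by
    intro M hM0 hM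
    calc M ^ N * Real.exp (-(l * t))
        ≤ Real.exp (p * q * l ^ 2 / (2 * (1 - l / 3))) ^ N * Real.exp (-(l * t)) := by gcongr
      _ = Real.exp (N * (p * q * l ^ 2 / (2 * (1 - l / 3))) - l * t) := by
        rw [← Real.exp_nat_mul, ← Real.exp_add]; ring_nf
      _ ≤ _ := Real.exp_le_exp.2 hexp
  have hm1 := hbound _ (by positivity) (bern_mgf p q l hp0 hq0 (by linarith) hl0.le hl3)
  have hm2 := hbound (p * Real.exp (-(l * q)) + q * Real.exp (l * p)) (by positivity) (by
    have := bern_mgf q p l hq0 hp0 (by linarith) hl0.le hl3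
    rw [mul_comm q p] at this
    linarith)
  rw [← bern_pow, Finset.sum_mul] at hm1 hm2
  rw [two_mul]
  refine lt_of_lt_of_le ?_ (add_le_add hm1 hm2)
  rw [← Finset.sum_add_distrib]
  apply Finset.sum_lt_sum_of_nonempty (by simp)
  intro k hk
  have hk' : k ≤ N := by simpa [Nat.lt_succ_iff] using hk
  have hw : 0 < (N.choose k : ℝ) * p ^ k * q ^ (N - k) := by
    have : 0 < N.choose k := Nat.choose_pos hk'
    positivity
  have e1 : Real.exp (k * (l * q) + (N - k) * (-(l * p))) * Real.exp (-(l * t)) =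
      Real.exp (l * (k - N * p - t)) := by
    rw [← Real.exp_add, hq]; ring_nf
  have e2 : Real.exp (k * (-(l * q)) + (N - k) * (l * p)) * Real.exp (-(l * t)) =
      Real.exp (l * (-(k - N * p) - t)) := by
    rw [← Real.exp_add, hq]; ring_nf
  rw [mul_assoc _ _ (Real.exp (-(l * t))), mul_assoc _ _ (Real.exp (-(l * t))), e1, e2, ← mul_add]
  have p1 := Real.exp_pos (l * (k - N * p - t))
  have p2 := Real.exp_pos (l * (-(k - N * p) - t))
  split_ifs with h
  · have : 1 < Real.exp (l * (k - N * p - t)) + Real.exp (l * (-(k - N * p) - t)) := by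
      rcases lt_abs.1 h with h | h
      · have := Real.one_le_exp (x := l * (k - N * p - t)) (mul_nonneg hl0.le (by linarith))
        linarith
      · have := Real.one_le_exp (x := l * (-(k - N * p) - t)) (mul_nonneg hl0.le (by linarith))
        linarith
    exact lt_mul_of_one_lt_right hw this
  · positivity
end

section
/- There exists an absolute constant C > 1 such that the following holds, where A ≥ 2 is a constant. For every δ > 0 there exists n₀ such that for all n ≥ n₀, all ε, p ∈ (0,1) with ε³np² ≥ A²C, and every weakly (p, A√(np))-bijumbled graph G of order n: if an orientation of G is chosen uniformly at random among all 2^{e(G)} orientations, then with probability at least 1 − δ, for every set X ⊆ V(G) with |X| = 2√ε·np, the set N¹(X) = ∪_{x∈X} N¹(x) of out-neighbors of vertices of X satisfies |N¹(X)| ≥ (1 − 2√ε)·n. -/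
/-- The probability that an orientation of `G`, chosen uniformly at random among the
`2^{e(G)}` orientations of `G`, belongs to the set `S`. -/
noncomputable def orientProb {V : Type*} (G : SimpleGraph V) (S : Set (V → V → Prop)) : ℝ :=
  (Nat.card {D : V → V → Prop // IsOrientation G D ∧ D ∈ S} : ℝ) / 2 ^ G.edgeSet.ncard

open Classical in
/-- lower bound on the number of orientations -/
lemma two_pow_le_orientations {n : ℕ} (G : SimpleGraph (Fin n)) :
    2 ^ G.edgeSet.ncard ≤ {D : Fin n → Fin n → Prop | IsOrientation G D}.ncard := by
  rw [← Set.ncard_powerset G.edgeSet (Set.toFinite _)]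
  refine Set.ncard_le_ncard_of_injOn
    (fun S u v => G.Adj u v ∧ ((u < v ∧ s(u, v) ∈ S) ∨ (v < u ∧ s(u, v) ∉ S))) ?_ ?_ (Set.toFinite _)
  · intro S hS
    refine ⟨fun u v h => h.1, fun u v h => ?_⟩
    have hne := h.ne
    have h2 := h.symm
    have e : s(v, u) = s(u, v) := Sym2.eq_swap
    simp only [h, h2, e, true_and]
    rcases lt_or_gt_of_ne hne with h3 | h3
    · simp [h3, h3.not_gt]
    · simp [h3, h3.not_gt]
  · have key : ∀ S T : Set (Sym2 (Fin n)), S ⊆ G.edgeSet →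
        (fun u v => G.Adj u v ∧ ((u < v ∧ s(u, v) ∈ S) ∨ (v < u ∧ s(u, v) ∉ S))) =
        (fun u v => G.Adj u v ∧ ((u < v ∧ s(u, v) ∈ T) ∨ (v < u ∧ s(u, v) ∉ T))) → S ⊆ T := by
      intro S T hS h e he
      have hE := hS he
      induction e with
      | _ u v =>
        rw [SimpleGraph.mem_edgeSet] at hE
        have h1 := congrFun (congrFun h u) v
        simp only [hE, he, true_and, eq_iff_iff] at h1
        rcases lt_or_gt_of_ne hE.ne with h3 | h3
        · simpa [h3, h3.not_gt] using h1
        · simpa [h3, h3.not_gt] using h1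
    intro S hS T hT h
    exact Set.Subset.antisymm (key S T hS h) (key T S hT h.symm)

/-- orientations with no arc from U to W -/
lemma bad_orientations {n : ℕ} (G : SimpleGraph (Fin n)) (U W : Set (Fin n)) :
    {D : Fin n → Fin n → Prop | IsOrientation G D ∧ ∀ u ∈ U, ∀ w ∈ W, ¬ D u w}.ncard
      * 2 ^ edgesBetween G U W ≤ 2 ^ G.edgeSet.ncard := by
  set B : Set (Sym2 (Fin n)) := {e ∈ G.edgeSet | ∃ x ∈ U, ∃ y ∈ W, e = s(x, y)} with hB
  have hBE : B ⊆ G.edgeSet := fun e he => he.1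
  have hcard : (G.edgeSet \ B).ncard + edgesBetween G U W = G.edgeSet.ncard :=
    Set.ncard_sdiff_add_ncard_of_subset hBE (Set.toFinite _)
  rw [← hcard, pow_add]
  refine Nat.mul_le_mul_right _ ?_
  rw [← Set.ncard_powerset (G.edgeSet \ B) (Set.toFinite _)]
  refine Set.ncard_le_ncard_of_injOn
    (fun D => {e | e ∈ G.edgeSet \ B ∧ ∃ u v, u < v ∧ e = s(u, v) ∧ D u v}) ?_ ?_ (Set.toFinite _)
  · intro D _ e he
    exact he.1
  · have mem : ∀ D : Fin n → Fin n → Prop, ∀ u v, u < v →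
        ((∃ u' v', u' < v' ∧ s(u, v) = s(u', v') ∧ D u' v') ↔ D u v) := by
      intro D u v huv
      constructor
      · rintro ⟨u', v', h1, h2, h3⟩
        rw [Sym2.eq_iff] at h2
        rcases h2 with ⟨rfl, rfl⟩ | ⟨rfl, rfl⟩
        · exact h3
        · exact absurd huv h1.not_gt
      · intro h
        exact ⟨u, v, huv, rfl, h⟩
    have lt_case : ∀ D D' : Fin n → Fin n → Prop,
        (IsOrientation G D ∧ ∀ u ∈ U, ∀ w ∈ W, ¬ D u w) →
        (IsOrientation G D' ∧ ∀ u ∈ U, ∀ w ∈ W, ¬ D' u w) →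
        ({e | e ∈ G.edgeSet \ B ∧ ∃ u v, u < v ∧ e = s(u, v) ∧ D u v} : Set (Sym2 (Fin n))) =
        {e | e ∈ G.edgeSet \ B ∧ ∃ u v, u < v ∧ e = s(u, v) ∧ D' u v} →
        ∀ u v, G.Adj u v → u < v → (D u v ↔ D' u v) := by
      intro D D' hD hD' h u v huv hlt
      by_cases hb : s(u, v) ∈ B
      · obtain ⟨_, x, hx, y, hy, hxy⟩ := hb
        rw [Sym2.eq_iff] at hxy
        rcases hxy with ⟨rfl, rfl⟩ | ⟨rfl, rfl⟩
        · exact iff_of_false (hD.2 _ hx _ hy) (hD'.2 _ hx _ hy)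
        · exact iff_of_true ((hD.1.2 _ _ huv).2 (hD.2 _ hx _ hy))
            ((hD'.1.2 _ _ huv).2 (hD'.2 _ hx _ hy))
      · have h1 := Set.ext_iff.1 h s(u, v)
        simp only [Set.mem_ofPred_eq, mem _ u v hlt] at h1
        have h2 : s(u, v) ∈ G.edgeSet \ B := ⟨huv, hb⟩
        simpa [h2] using h1
    intro D hD D' hD' h
    funext u v
    apply propext
    by_cases huv : G.Adj u v
    · rcases lt_or_gt_of_ne huv.ne with h3 | h3
      · exact lt_case D D' hD hD' h u v huv h3
      · rw [hD.1.2 _ _ huv, hD'.1.2 _ _ huv, lt_case D D' hD hD' h v u huv.symm h3]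
    · exact iff_of_false (fun hh => huv (hD.1.1 _ _ hh)) (fun hh => huv (hD'.1.1 _ _ hh))

/-- numeric estimate -/
lemma many_edges {A n ε p s u w e : ℝ} (hA : 2 ≤ A) (hs0 : 0 < s) (hs1 : s < 1) (hse : s ^ 2 = ε)
    (hp0 : 0 < p) (hn : 0 < n)
    (h : A ^ 2 * 100 ≤ ε ^ 3 * n * p ^ 2) (hu : s * n * p / 2 ≤ u) (hw : s * n ≤ w)
    (he : |e - p * u * w| ≤ A * Real.sqrt (n * p) * Real.sqrt (u * w)) : 8 * n ≤ e := by
  have hu0 : 0 < u := lt_of_lt_of_le (by positivity) hu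
  have hw0 : 0 < w := lt_of_lt_of_le (by positivity) hw
  have hε0 : 0 < ε := by rw [← hse]; positivity
  have hε1 : ε < 1 := by rw [← hse]; nlinarith
  have h1 : ε * n ^ 2 * p / 2 ≤ u * w := by
    calc ε * n ^ 2 * p / 2 = (s * n * p / 2) * (s * n) := by rw [← hse]; ring
      _ ≤ u * w := by gcongr
  have hε3 : ε ^ 3 * n * p ^ 2 ≤ ε * n * p ^ 2 := by
    have : ε ^ 3 ≤ ε := by
      calc ε ^ 3 ≤ ε ^ 1 := pow_le_pow_of_le_one hε0.le hε1.le (by norm_num)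
        _ = ε := pow_one _
    gcongr
  have h2 : A ^ 2 * 100 ≤ ε * n * p ^ 2 := h.trans hε3
  have h3 : A * Real.sqrt (n * p) ≤ p * Real.sqrt (u * w) / 2 := by
    have : (2 * A) ^ 2 * (n * p) ≤ p ^ 2 * (u * w) := by
      calc (2 * A) ^ 2 * (n * p) = (A ^ 2 * 4) * (n * p) := by ring
        _ ≤ (ε * n * p ^ 2 / 2) * (n * p) := by gcongr; nlinarith
        _ = p ^ 2 * (ε * n ^ 2 * p / 2) := by ring
        _ ≤ p ^ 2 * (u * w) := by gcongr
    have h4 := Real.sqrt_le_sqrt this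
    rw [Real.sqrt_mul (sq_nonneg (2 * A)), Real.sqrt_mul (sq_nonneg p),
      Real.sqrt_sq (by positivity), Real.sqrt_sq (by positivity)] at h4
    linarith
  have h5 : A * Real.sqrt (n * p) * Real.sqrt (u * w) ≤ p * (u * w) / 2 := by
    calc _ ≤ p * Real.sqrt (u * w) / 2 * Real.sqrt (u * w) := by gcongr
      _ = p * (Real.sqrt (u * w) * Real.sqrt (u * w)) / 2 := by ring
      _ = _ := by rw [Real.mul_self_sqrt (by positivity)]
  have h6 := (abs_le.1 he).1
  have h7 : p * (u * w) / 2 ≤ e := by nlinarith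
  have h8 : p * (ε * n ^ 2 * p / 2) ≤ p * (u * w) := by gcongr
  have h9 : (A ^ 2 * 100) * n ≤ ε * n * p ^ 2 * n := by gcongr
  nlinarith [mul_le_mul_of_nonneg_right (show (4:ℝ) ≤ A ^ 2 by nlinarith) hn.le]

/-- a failing set yields a bad pair -/
lemma exists_bad_pair {n : ℕ} {A ε p : ℝ} (hA : 2 ≤ A) (hε : ε ∈ Set.Ioo (0 : ℝ) 1)
    (hp : p ∈ Set.Ioo (0 : ℝ) 1) (h : A ^ 2 * 100 ≤ ε ^ 3 * n * p ^ 2)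
    (G : SimpleGraph (Fin n)) (hG : WeaklyBijumbled G p (A * Real.sqrt (n * p)))
    (D : Fin n → Fin n → Prop) (X : Set (Fin n))
    (hX : (X.ncard : ℝ) = 2 * Real.sqrt ε * n * p)
    (hN : ((⋃ x ∈ X, firstNbhd D x).ncard : ℝ) < (1 - 2 * Real.sqrt ε) * n) :
    ∃ U W : Set (Fin n), 8 * n ≤ edgesBetween G U W ∧ ∀ u ∈ U, ∀ w ∈ W, ¬ D u w := by
  obtain ⟨hε0, hε1⟩ := hε
  obtain ⟨hp0, hp1⟩ := hp
  set s := Real.sqrt ε with hs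
  have hse : s ^ 2 = ε := Real.sq_sqrt hε0.le
  have hs0 : 0 < s := Real.sqrt_pos.2 hε0
  have hs1 : s < 1 := by nlinarith
  have hn : (0 : ℝ) < n := by
    rcases Nat.eq_zero_or_pos n with h0 | h0
    · subst h0; simp at h; nlinarith
    · exact_mod_cast h0
  have hA2 : (4 : ℝ) ≤ A ^ 2 := by nlinarith
  have h6 : s ^ 6 * (n * p ^ 2) ≤ s * (n * p ^ 2) := by
    have : s ^ 6 ≤ s ^ 1 := pow_le_pow_of_le_one hs0.le hs1.le (by norm_num)
    rw [pow_one] at this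
    gcongr
  have hbig : 400 ≤ s * (n * p ^ 2) := by
    have : ε ^ 3 * n * p ^ 2 = s ^ 6 * (n * p ^ 2) := by rw [← hse]; ring
    linarith
  have hbig2 : 400 ≤ s * n * p := by
    have : s * n * p * p ≤ s * n * p * 1 := by gcongr
    nlinarith
  set k := X.ncard with hk
  obtain ⟨U, hUX, hU⟩ := Set.exists_subset_card_eq (s := X) (n := k / 2) (by omega)
  set N := ⋃ x ∈ X, firstNbhd D x with hNdef
  have hd1 : (2 * U.ncard : ℝ) ≤ k := by
    have : 2 * U.ncard ≤ k := by omega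
    exact_mod_cast this
  have hd2 : (k : ℝ) ≤ 2 * U.ncard + 1 := by
    have : k ≤ 2 * U.ncard + 1 := by omega
    exact_mod_cast this
  have hWc : n ≤ (Nᶜ \ U).ncard + N.ncard + U.ncard := by
    have a1 := Set.ncard_add_ncard_compl N
    have a2 := Set.le_ncard_sdiff U Nᶜ
    simp at a1
    omega
  have hWc' : (n : ℝ) ≤ (Nᶜ \ U).ncard + N.ncard + U.ncard := by exact_mod_cast hWc
  have hWn : ((Nᶜ \ U).ncard : ℝ) ≤ n := by
    have := Set.ncard_le_card (Nᶜ \ U)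
    simp at this
    exact_mod_cast this
  have hsnp : s * n * p ≤ s * n := by
    have : s * n * p ≤ s * n * 1 := by gcongr
    linarith
  have hu : s * n * p / 2 ≤ U.ncard := by linarith
  have hw : s * n ≤ (Nᶜ \ U).ncard := by linarith
  refine ⟨U, Nᶜ \ U, ?_, ?_⟩
  · have hj := hG U (Nᶜ \ U) Set.disjoint_sdiff_right ?_ ?_ ?_
    · have := many_edges hA hs0 hs1 hse hp0 hn h hu hw hj
      exact_mod_cast this
    · have : (1 : ℝ) ≤ U.ncard := by linarith
      exact_mod_cast this
    · have : (U.ncard : ℝ) ≤ (Nᶜ \ U).ncard := by linarith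
      exact_mod_cast this
    · rw [Fintype.card_fin]
      refine hWn.trans ?_
      have : (n : ℝ) * p * (s * n * p / 2) ≤ n * p * U.ncard := by gcongr
      nlinarith
  · intro u hu w hw hD
    apply hw.1
    simp only [hNdef, Set.mem_iUnion]
    exact ⟨u, hUX hu, hD⟩

/-- There is an absolute constant `C > 1` such that for every constant
`A ≥ 2` and every `δ > 0` there is `n₀` such that for all `n ≥ n₀`, all `ε, p ∈ (0,1)`
with `ε³np² ≥ A²C`, and every weakly `(p, A√(np))`-bijumbled graph `G` of order `n`: a
uniformly random orientation of `G` satisfies, with probability at least `1 − δ`, that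
every `X ⊆ V(G)` with `|X| = 2√ε np` has `|N¹(X)| ≥ (1 − 2√ε) n`. -/
theorem bijumbled_random_orientation_expansion :
    ∃ C : ℝ, 1 < C ∧ ∀ A : ℝ, 2 ≤ A → ∀ δ : ℝ, 0 < δ → ∃ n₀ : ℕ, ∀ n : ℕ, n₀ ≤ n →
      ∀ ε p : ℝ, ε ∈ Set.Ioo (0 : ℝ) 1 → p ∈ Set.Ioo (0 : ℝ) 1 →
        A ^ 2 * C ≤ ε ^ 3 * n * p ^ 2 →
        ∀ G : SimpleGraph (Fin n), WeaklyBijumbled G p (A * Real.sqrt (n * p)) →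
          1 - δ ≤ orientProb G
            {D | ∀ X : Set (Fin n), (X.ncard : ℝ) = 2 * Real.sqrt ε * n * p →
              (1 - 2 * Real.sqrt ε) * n ≤ ((⋃ x ∈ X, firstNbhd D x).ncard : ℝ)} := by
  classical
  refine ⟨100, by norm_num, fun A hA δ hδ => ?_⟩
  obtain ⟨n₀, hn₀⟩ := exists_pow_lt_of_lt_one hδ (show (1 / 2 : ℝ) < 1 by norm_num)
  refine ⟨n₀, fun n hn ε p hε hp h G hG => ?_⟩
  set S : Set (Fin n → Fin n → Prop) := {D | ∀ X : Set (Fin n), (X.ncard : ℝ) = 2 * Real.sqrt ε * n * p →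
              (1 - 2 * Real.sqrt ε) * n ≤ ((⋃ x ∈ X, firstNbhd D x).ncard : ℝ)} with hS
  set m := G.edgeSet.ncard with hm
  set bad : Set (Fin n) × Set (Fin n) → Set (Fin n → Fin n → Prop) := fun q =>
    {D | IsOrientation G D ∧ ∀ u ∈ q.1, ∀ w ∈ q.2, ¬ D u w} with hbad
  set P : Finset (Set (Fin n) × Set (Fin n)) :=
    Finset.univ.filter (fun q => 8 * n ≤ edgesBetween G q.1 q.2) with hP
  have hcover : {D : Fin n → Fin n → Prop | IsOrientation G D} ⊆
      {D | IsOrientation G D ∧ D ∈ S} ∪ ⋃ q ∈ P, bad q := by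
    intro D hD
    by_cases hDS : D ∈ S
    · exact Or.inl ⟨hD, hDS⟩
    · right
      simp only [hS, Set.mem_ofPred_eq, not_forall, not_le] at hDS
      obtain ⟨X, hX, hN⟩ := hDS
      obtain ⟨U, W, h1, h2⟩ := exists_bad_pair hA hε hp h G hG D X hX hN
      simp only [Set.mem_iUnion]
      exact ⟨(U, W), by simp [hP, h1], hD, h2⟩
  have hb : ∀ q ∈ P, ((bad q).ncard : ℝ) ≤ 2 ^ m / 2 ^ (8 * n) := by
    intro q hq
    have h1 : 8 * n ≤ edgesBetween G q.1 q.2 := by simpa [hP] using hq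
    have h2 := bad_orientations G q.1 q.2
    have h3 : (bad q).ncard * 2 ^ (8 * n) ≤ 2 ^ m :=
      (Nat.mul_le_mul_left _ (Nat.pow_le_pow_right (by norm_num) h1)).trans h2
    rw [le_div_iff₀ (by positivity)]
    exact_mod_cast h3
  have hPc : (P.card : ℝ) ≤ 2 ^ (2 * n) := by
    have : P.card ≤ 2 ^ (2 * n) := by
      refine (Finset.card_le_univ P).trans ?_
      simp [Fintype.card_prod, two_mul, pow_add]
    exact_mod_cast this
  have hun : ((⋃ q ∈ P, bad q).ncard : ℝ) ≤ ∑ q ∈ P, ((bad q).ncard : ℝ) := by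
    have := Finset.set_ncard_biUnion_le P bad
    exact_mod_cast this
  have hsum : ∑ q ∈ P, ((bad q).ncard : ℝ) ≤ P.card * (2 ^ m / 2 ^ (8 * n)) := by
    rw [← nsmul_eq_mul]
    exact Finset.sum_le_card_nsmul _ _ _ hb
  have htot : (2 : ℝ) ^ m ≤ ({D | IsOrientation G D ∧ D ∈ S} : Set (Fin n → Fin n → Prop)).ncard
      + ((⋃ q ∈ P, bad q).ncard : ℝ) := by
    have := (two_pow_le_orientations G).trans
      ((Set.ncard_le_ncard hcover (Set.toFinite _)).trans (Set.ncard_union_le _ _))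
    exact_mod_cast this
  have hfin : (P.card : ℝ) * (2 ^ m / 2 ^ (8 * n)) ≤ δ * 2 ^ m := by
    have h1 : (2 : ℝ) ^ (2 * n) / 2 ^ (8 * n) ≤ δ := by
      have e1 : (2 : ℝ) ^ (2 * n) / 2 ^ (8 * n) ≤ (1 / 2) ^ n := by
        rw [div_le_iff₀ (by positivity), one_div, inv_pow, inv_mul_eq_div,
          le_div_iff₀ (by positivity), ← pow_add]
        exact pow_le_pow_right₀ (by norm_num) (by omega)
      have e2 : (1 / 2 : ℝ) ^ n ≤ (1 / 2) ^ n₀ :=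
        pow_le_pow_of_le_one (by norm_num) (by norm_num) hn
      linarith
    calc (P.card : ℝ) * (2 ^ m / 2 ^ (8 * n)) ≤ 2 ^ (2 * n) * (2 ^ m / 2 ^ (8 * n)) := by gcongr
      _ = 2 ^ (2 * n) / 2 ^ (8 * n) * 2 ^ m := by ring
      _ ≤ δ * 2 ^ m := by gcongr
  unfold orientProb
  rw [le_div_iff₀ (by positivity)]
  have hc : Nat.card {D : Fin n → Fin n → Prop // IsOrientation G D ∧ D ∈ S} =
      ({D | IsOrientation G D ∧ D ∈ S} : Set (Fin n → Fin n → Prop)).ncard := rfl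
  rw [hc]
  linarith
end
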